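/- Let G = A_1(4) act on ℂ[Z_1,Z_2,Z_3,Z_4] by g·Z_i = g_{ii} Z_i, and let I_G = ⟨Z_1^2, Z_2^2, Z_3^2, Z_4^2, Z_1Z_2Z_3Z_4⟩. Then the ideal I = ⟨Z_2Z_3, Z_2Z_4, Z_3Z_4⟩ + I_G is G-invariant, the quotient ℂ[Z_1,…,Z_4]/I has dimension 8 with basis the classes of 1, Z_1, Z_2, Z_3, Z_4, Z_1Z_2, Z_1Z_3, Z_1Z_4, and it is isomorphic to the regular representation of G, i.e. each of the 8 characters of G occurs in it with multiplicity one. -/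

import Mathlib

open MvPolynomial

noncomputable section

/-- The abelian group `A_r(n)`: diagonal matrices (encoded as tuples of units)
`d` with `d i ^ (r+1) = 1` for all `i` and `∏ i, d i = 1` (determinant one). -/
def ArGroup (r n : ℕ) : Subgroup (Fin n → ℂˣ) where
  carrier := {d | (∀ i, d i ^ (r + 1) = 1) ∧ ∏ i, d i = 1}
  one_mem' := ⟨fun _ => one_pow _, Finset.prod_const_one⟩
  mul_mem' := by
    rintro a b ⟨ha1, ha2⟩ ⟨hb1, hb2⟩
    refine ⟨fun i => ?_, ?_⟩
    · simp [Pi.mul_apply, mul_pow, ha1 i, hb1 i]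
    · simp [Finset.prod_mul_distrib, ha2, hb2]
  inv_mem' := by
    rintro a ⟨ha1, ha2⟩
    refine ⟨fun i => ?_, ?_⟩
    · rw [Pi.inv_apply, inv_pow, ha1 i, inv_one]
    · simp [Finset.prod_inv_distrib, ha2]

/-- The action of a diagonal element `d` on polynomials, `Z i ↦ d i • Z i`. -/
def actA {n : ℕ} (d : Fin n → ℂˣ) :
    MvPolynomial (Fin n) ℂ →ₐ[ℂ] MvPolynomial (Fin n) ℂ :=
  aeval fun i => C (d i : ℂ) * X i

/-- The `ρ`-isotypic component (as a set) of the `A_r(n)`-module `ℂ[Z]/I`: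
those classes `w` such that for every `g` in the group and every representative `p`
of `w`, the class of `g · p` equals `ρ(g) • w`. -/
def iso (r n : ℕ) (I : Ideal (MvPolynomial (Fin n) ℂ)) (ρ : ArGroup r n →* ℂˣ) :
    Set (MvPolynomial (Fin n) ℂ ⧸ I) :=
  {w | ∀ g : ArGroup r n, ∀ p, Ideal.Quotient.mk I p = w →
    Ideal.Quotient.mk I (actA (g : Fin n → ℂˣ) p) = (ρ g : ℂ) • w}

end

lemma coeff_actA {n : ℕ} (d : Fin n → ℂˣ) (p : MvPolynomial (Fin n) ℂ) (m : Fin n →₀ ℕ) :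
    coeff m (actA d p) = (∏ j, (d j : ℂ) ^ m j) * coeff m p := by
  classical
  induction p using MvPolynomial.induction_on' with
  | add p q hp hq => rw [map_add, coeff_add, coeff_add, hp, hq, mul_add]
  | monomial u a =>
    have h : actA d (monomial u a) = monomial u ((∏ j, (d j : ℂ) ^ u j) * a) := by
      rw [actA, aeval_monomial, Finsupp.prod_fintype _ _ (fun _ => pow_zero _),
        monomial_eq, Finsupp.prod_fintype _ _ (fun _ => pow_zero _)]
      simp only [mul_pow, Finset.prod_mul_distrib, algebraMap_eq, map_mul, map_prod, map_pow]
      ring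
    rw [h, coeff_monomial, coeff_monomial]
    split_ifs with hu
    · rw [hu]
    · rw [mul_zero]

/-- The ideal generated by the monomials with exponents in `S`. -/
noncomputable def monomialIdeal {n : ℕ} (S : Set (Fin n →₀ ℕ)) : Ideal (MvPolynomial (Fin n) ℂ) :=
  Ideal.span ((fun s => monomial s (1 : ℂ)) '' S)

section monomialIdeal

variable {n : ℕ} {S : Set (Fin n →₀ ℕ)}

lemma mem_monomialIdeal_iff {p : MvPolynomial (Fin n) ℂ} :
    p ∈ monomialIdeal S ↔ ∀ m, (∀ s ∈ S, ¬ s ≤ m) → coeff m p = 0 := by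
  rw [monomialIdeal, mem_ideal_span_monomial_image]
  refine forall_congr' fun m => ?_
  rw [mem_support_iff]
  constructor
  · intro h hm
    by_contra hc
    obtain ⟨s, hs, hsm⟩ := h hc
    exact hm s hs hsm
  · intro h hc
    by_contra! hm
    exact hc (h hm)

lemma actA_mem_monomialIdeal (d : Fin n → ℂˣ) {p : MvPolynomial (Fin n) ℂ}
    (hp : p ∈ monomialIdeal S) : actA d p ∈ monomialIdeal S := by
  rw [mem_monomialIdeal_iff] at hp ⊢
  intro m hm
  rw [coeff_actA, hp m hm, mul_zero]

variable {ι : Type*} {e : ι → Fin n →₀ ℕ}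

lemma linearIndependent_mk_monomial (he : Function.Injective e)
    (hS : ∀ i, ∀ s ∈ S, ¬ s ≤ e i) :
    LinearIndependent ℂ
      fun i => Ideal.Quotient.mk (monomialIdeal S) (monomial (e i) (1 : ℂ)) := by
  classical
  rw [linearIndependent_iff']
  intro t a h i hi
  have h' : Ideal.Quotient.mk (monomialIdeal S) (∑ j ∈ t, monomial (e j) (a j)) = 0 := by
    rw [← h, map_sum]
    refine Finset.sum_congr rfl fun j _ => ?_
    rw [← Ideal.Quotient.mkₐ_eq_mk ℂ, ← map_smul, smul_monomial, smul_eq_mul, mul_one]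
  rw [Ideal.Quotient.eq_zero_iff_mem, mem_monomialIdeal_iff] at h'
  simpa [coeff_sum, coeff_monomial, he.eq_iff, hi] using h' (e i) (hS i)

lemma span_mk_monomial_eq_top (hS : ∀ m, (∀ s ∈ S, ¬ s ≤ m) → ∃ i, e i = m) :
    Submodule.span ℂ (Set.range
      fun i => Ideal.Quotient.mk (monomialIdeal S) (monomial (e i) (1 : ℂ))) = ⊤ := by
  classical
  rw [eq_top_iff]
  rintro w -
  obtain ⟨p, rfl⟩ := Ideal.Quotient.mk_surjective w
  induction p using MvPolynomial.induction_on' with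
  | add p q hp hq => rw [map_add]; exact add_mem hp hq
  | monomial u a =>
    by_cases hu : ∀ s ∈ S, ¬ s ≤ u
    · obtain ⟨i, rfl⟩ := hS u hu
      have h : Ideal.Quotient.mk (monomialIdeal S) (monomial (e i) a) =
          a • Ideal.Quotient.mk (monomialIdeal S) (monomial (e i) (1 : ℂ)) := by
        rw [← Ideal.Quotient.mkₐ_eq_mk ℂ, ← map_smul, smul_monomial, smul_eq_mul, mul_one]
      rw [h]
      exact Submodule.smul_mem _ _ (Submodule.subset_span ⟨i, rfl⟩)
    · have h : monomial u a ∈ monomialIdeal S := by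
        rw [mem_monomialIdeal_iff]
        intro m hm
        rw [coeff_monomial, if_neg]
        rintro rfl
        exact hu hm
      rw [Ideal.Quotient.eq_zero_iff_mem.mpr h]
      exact zero_mem _

variable {r : ℕ} {ρ : ArGroup r n →* ℂˣ}

lemma mk_mem_iso_iff {p : MvPolynomial (Fin n) ℂ} :
    Ideal.Quotient.mk (monomialIdeal S) p ∈ iso r n (monomialIdeal S) ρ ↔
      ∀ g : ArGroup r n, ∀ m, (∀ s ∈ S, ¬ s ≤ m) →
        (∏ j, ((g : Fin n → ℂˣ) j : ℂ) ^ m j) * coeff m p = ρ g * coeff m p := by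
  have key (g : ArGroup r n) (q : MvPolynomial (Fin n) ℂ) :
      Ideal.Quotient.mk (monomialIdeal S) (actA (g : Fin n → ℂˣ) q) =
        (ρ g : ℂ) • Ideal.Quotient.mk (monomialIdeal S) p ↔
      ∀ m, (∀ s ∈ S, ¬ s ≤ m) →
        (∏ j, ((g : Fin n → ℂˣ) j : ℂ) ^ m j) * coeff m q = ρ g * coeff m p := by
    have h : (ρ g : ℂ) • Ideal.Quotient.mk (monomialIdeal S) p =
        Ideal.Quotient.mk (monomialIdeal S) ((ρ g : ℂ) • p) :=
      (map_smul (Ideal.Quotient.mkₐ ℂ (monomialIdeal S)) _ _).symm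
    rw [h, Ideal.Quotient.eq, mem_monomialIdeal_iff]
    simp only [coeff_sub, coeff_actA, coeff_smul, smul_eq_mul, sub_eq_zero]
  constructor
  · exact fun h g => (key g p).mp (h g p rfl)
  · intro h g q hq
    rw [key]
    intro m hm
    rw [Ideal.Quotient.eq, mem_monomialIdeal_iff] at hq
    rw [← h g m hm, sub_eq_zero.mp ((coeff_sub _ _ _ _).symm.trans (hq m hm))]

lemma exists_iso_generator {k : Fin n →₀ ℕ} (hk : ∀ s ∈ S, ¬ s ≤ k)
    (hρ : ∀ g : ArGroup r n, ∏ j, ((g : Fin n → ℂˣ) j : ℂ) ^ k j = ρ g)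
    (huniq : ∀ m, (∀ s ∈ S, ¬ s ≤ m) →
      (∀ g : ArGroup r n, ∏ j, ((g : Fin n → ℂˣ) j : ℂ) ^ m j = ρ g) → m = k) :
    ∃ w ∈ iso r n (monomialIdeal S) ρ, w ≠ 0 ∧
      ∀ w' ∈ iso r n (monomialIdeal S) ρ, ∃ a : ℂ, w' = a • w := by
  classical
  refine ⟨Ideal.Quotient.mk _ (monomial k 1), ?_, ?_, ?_⟩
  · rw [mk_mem_iso_iff]
    intro g m _
    rw [coeff_monomial]
    split_ifs with h
    · rw [← h, hρ]
    · rw [mul_zero, mul_zero]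
  · rw [Ne, Ideal.Quotient.eq_zero_iff_mem, mem_monomialIdeal_iff]
    intro h
    simpa using h k hk
  · intro w' hw'
    obtain ⟨p, rfl⟩ := Ideal.Quotient.mk_surjective w'
    rw [mk_mem_iso_iff] at hw'
    refine ⟨coeff k p, ?_⟩
    rw [← Ideal.Quotient.mkₐ_eq_mk ℂ, ← map_smul, Ideal.Quotient.mkₐ_eq_mk, Ideal.Quotient.eq,
      mem_monomialIdeal_iff]
    intro m hm
    by_cases hmk : m = k
    · simp [hmk]
    · have h0 : coeff m p = 0 := by
        by_contra hc
        exact hmk (huniq m hm fun g => mul_right_cancel₀ hc (hw' g m hm))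
      simp [h0, coeff_monomial, Ne.symm hmk]

end monomialIdeal

/-- The exponent vector `(a, b, c, d)`. -/
noncomputable def expVec (a b c d : ℕ) : Fin 4 →₀ ℕ := Finsupp.equivFunOnFinite.symm ![a, b, c, d]

lemma monomial_expVec (a b c d : ℕ) :
    monomial (expVec a b c d) (1 : ℂ) = X 0 ^ a * X 1 ^ b * X 2 ^ c * X 3 ^ d := by
  rw [monomial_eq, Finsupp.prod_fintype _ _ (fun _ => pow_zero _)]
  simp [expVec, Fin.prod_univ_four]

lemma expVec_le_iff (a b c d : ℕ) (m : Fin 4 →₀ ℕ) :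
    expVec a b c d ≤ m ↔ a ≤ m 0 ∧ b ≤ m 1 ∧ c ≤ m 2 ∧ d ≤ m 3 := by
  simp [Finsupp.le_def, expVec, Fin.forall_fin_succ]

lemma expVec_eq_iff (a b c d : ℕ) (m : Fin 4 →₀ ℕ) :
    expVec a b c d = m ↔ a = m 0 ∧ b = m 1 ∧ c = m 2 ∧ d = m 3 := by
  simp [Finsupp.ext_iff, expVec, Fin.forall_fin_succ]

/-- Exponents of the monomial generators of the ideal. -/
noncomputable def genExponents : Set (Fin 4 →₀ ℕ) :=
  {expVec 0 1 1 0, expVec 0 1 0 1, expVec 0 0 1 1, expVec 2 0 0 0, expVec 0 2 0 0,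
    expVec 0 0 2 0, expVec 0 0 0 2, expVec 1 1 1 1}

/-- Exponents of the monomials outside the ideal. -/
noncomputable def stdExponent : Fin 8 → Fin 4 →₀ ℕ :=
  ![expVec 0 0 0 0, expVec 1 0 0 0, expVec 0 1 0 0, expVec 0 0 1 0, expVec 0 0 0 1,
    expVec 1 1 0 0, expVec 1 0 1 0, expVec 1 0 0 1]

lemma monomialIdeal_genExponents :
    monomialIdeal genExponents =
      Ideal.span {(X 1 : MvPolynomial (Fin 4) ℂ) * X 2, X 1 * X 3, X 2 * X 3} ⊔
      Ideal.span {(X 0 : MvPolynomial (Fin 4) ℂ) ^ 2, X 1 ^ 2, X 2 ^ 2, X 3 ^ 2,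
        X 0 * X 1 * X 2 * X 3} := by
  rw [monomialIdeal, genExponents, ← Ideal.span_union]
  simp only [Set.image_insert_eq, Set.image_singleton, monomial_expVec, Set.insert_union,
    Set.singleton_union, pow_zero, pow_one, one_mul, mul_one]

lemma forall_genExponents_not_le_iff (m : Fin 4 →₀ ℕ) :
    (∀ s ∈ genExponents, ¬ s ≤ m) ↔ ∃ i, stdExponent i = m := by
  simp only [genExponents, Set.mem_insert_iff, Set.mem_singleton_iff, forall_eq_or_imp,
    forall_eq, expVec_le_iff]
  constructor
  · rintro ⟨h1, h2, h3, h4, h5, h6, h7, -⟩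
    have h : (m 1 = 0 ∧ m 2 = 0 ∧ m 3 = 0) ∨ (m 1 = 1 ∧ m 2 = 0 ∧ m 3 = 0) ∨
        (m 1 = 0 ∧ m 2 = 1 ∧ m 3 = 0) ∨ (m 1 = 0 ∧ m 2 = 0 ∧ m 3 = 1) := by
      omega
    have h0 : m 0 = 0 ∨ m 0 = 1 := by omega
    simp only [stdExponent, Fin.exists_fin_succ, Matrix.cons_val_zero, Matrix.cons_val_succ,
      expVec_eq_iff, IsEmpty.exists_iff]
    rcases h0 with h0 | h0 <;> rcases h with h | h | h | h <;> simp [h0, h]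
  · rintro ⟨i, rfl⟩
    fin_cases i <;> simp [stdExponent, expVec]

lemma stdExponent_injective : Function.Injective stdExponent := by
  intro i j h
  have h' (k : Fin 4) : stdExponent i k = stdExponent j k := by rw [h]
  have h0 := h' 0
  have h1 := h' 1
  have h2 := h' 2
  have h3 := h' 3
  clear h h'
  fin_cases i <;> fin_cases j <;> simp_all [stdExponent, expVec]

/-- The element of `A_1(4)` with entries `-1` exactly at `0` and `k + 1`. -/
def signFlip (k : Fin 3) : ArGroup 1 4 :=
  ⟨![![-1, -1, 1, 1], ![-1, 1, -1, 1], ![-1, 1, 1, -1]] k, by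
    constructor
    · intro i
      fin_cases k <;> fin_cases i <;> simp
    · fin_cases k <;> simp [Fin.prod_univ_four]⟩

lemma neg_one_ne_one_units : (-1 : ℂˣ) ≠ 1 := by
  intro h
  have h' := congrArg Units.val h
  norm_num at h'

lemma eq_one_or_eq_neg_one_of_mem (g : ArGroup 1 4) (i : Fin 4) :
    (g : Fin 4 → ℂˣ) i = 1 ∨ (g : Fin 4 → ℂˣ) i = -1 := by
  have h := congrArg Units.val (g.2.1 i)
  simp only [Units.val_pow_eq_pow_val, Units.val_one, one_add_one_eq_two, sq_eq_one_iff] at h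
  exact h.imp (fun h => Units.ext h) fun h => Units.ext h

lemma closure_range_signFlip : Subgroup.closure (Set.range signFlip) = ⊤ := by
  classical
  rw [eq_top_iff]
  rintro g -
  have hg : g = ∏ k : Fin 3, if (g : Fin 4 → ℂˣ) k.succ = 1 then 1 else signFlip k := by
    have hdet := g.2.2
    rw [Fin.prod_univ_four] at hdet
    ext j : 2
    rcases eq_one_or_eq_neg_one_of_mem g 0 with h0 | h0 <;>
    rcases eq_one_or_eq_neg_one_of_mem g 1 with h1 | h1 <;>
    rcases eq_one_or_eq_neg_one_of_mem g 2 with h2 | h2 <;>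
    rcases eq_one_or_eq_neg_one_of_mem g 3 with h3 | h3 <;>
    simp only [h0, h1, h2, h3, mul_one, mul_neg, neg_neg, neg_one_ne_one_units] at hdet <;>
    fin_cases j <;>
    simp [Fin.prod_univ_three, signFlip, h0, h1, h2, h3]
  rw [hg]
  refine Subgroup.prod_mem _ fun k _ => ?_
  split_ifs
  · exact one_mem _
  · exact Subgroup.subset_closure ⟨k, rfl⟩

/-- The character `g ↦ ∏ j, g j ^ m j` by which `A_r(n)` acts on the monomial of exponent `m`. -/
def monomialChar {r n : ℕ} (m : Fin n →₀ ℕ) : ArGroup r n →* ℂˣ where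
  toFun g := ∏ j, (g : Fin n → ℂˣ) j ^ m j
  map_one' := by simp
  map_mul' g h := by simp [mul_pow, Finset.prod_mul_distrib]

lemma forall_prod_eq_iff {r n : ℕ} (m : Fin n →₀ ℕ) (ρ : ArGroup r n →* ℂˣ) :
    (∀ g : ArGroup r n, ∏ j, ((g : Fin n → ℂˣ) j : ℂ) ^ m j = ρ g) ↔ monomialChar m = ρ := by
  simp [MonoidHom.ext_iff, monomialChar, Units.ext_iff]

lemma monomialChar_eq_iff (m : Fin 4 →₀ ℕ) (ρ : ArGroup 1 4 →* ℂˣ) :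
    monomialChar m = ρ ↔ ∀ k, monomialChar m (signFlip k) = ρ (signFlip k) := by
  refine ⟨fun h k => by rw [h], fun h => ?_⟩
  refine MonoidHom.eq_of_eqOn_dense closure_range_signFlip ?_
  rintro _ ⟨k, rfl⟩
  exact h k

lemma map_signFlip (ρ : ArGroup 1 4 →* ℂˣ) (k : Fin 3) :
    ρ (signFlip k) = 1 ∨ ρ (signFlip k) = -1 := by
  have hsq : signFlip k ^ 2 = 1 := Subtype.ext (funext (signFlip k).2.1)
  have h := congrArg Units.val (congrArg ρ hsq)
  simp only [map_pow, map_one, Units.val_pow_eq_pow_val, Units.val_one, sq_eq_one_iff] at h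
  exact h.imp (fun h => Units.ext h) fun h => Units.ext h

lemma monomialChar_stdExponent_signFlip (i : Fin 8) (k : Fin 3) :
    monomialChar (stdExponent i) (signFlip k) =
      (![![1, 1, 1], ![-1, -1, -1], ![-1, 1, 1], ![1, -1, 1], ![1, 1, -1],
        ![1, -1, -1], ![-1, 1, -1], ![-1, -1, 1]] : Fin 8 → Fin 3 → ℂˣ) i k := by
  fin_cases i <;> fin_cases k <;>
    simp [monomialChar, stdExponent, expVec, signFlip, Fin.prod_univ_four]

lemma existsUnique_monomialChar_eq (ρ : ArGroup 1 4 →* ℂˣ) :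
    ∃! i, monomialChar (stdExponent i) = ρ := by
  have hne := neg_one_ne_one_units
  simp only [monomialChar_eq_iff, monomialChar_stdExponent_signFlip, Fin.forall_fin_succ,
    IsEmpty.forall_iff, and_true, ExistsUnique, Fin.exists_fin_succ, IsEmpty.exists_iff]
  rcases map_signFlip ρ 0 with h0 | h0 <;> rcases map_signFlip ρ 1 with h1 | h1 <;>
    rcases map_signFlip ρ 2 with h2 | h2 <;> simp [h0, h1, h2, hne, hne.symm]

/-- For `G = A_1(4)`, with `I_G = ⟨Z_1^2, Z_2^2, Z_3^2, Z_4^2,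
Z_1Z_2Z_3Z_4⟩`, the ideal `I = ⟨Z_2Z_3, Z_2Z_4, Z_3Z_4⟩ + I_G` is `G`-invariant,
the quotient has dimension `8` with basis the classes of
`1, Z_1, Z_2, Z_3, Z_4, Z_1Z_2, Z_1Z_3, Z_1Z_4`, and each of the `8` characters of
`G` occurs in it with multiplicity one. -/
theorem A14_ideal_xC1prime_regular :
    let IG : Ideal (MvPolynomial (Fin 4) ℂ) :=
      Ideal.span {(X 0 : MvPolynomial (Fin 4) ℂ) ^ 2, X 1 ^ 2, X 2 ^ 2, X 3 ^ 2,
        X 0 * X 1 * X 2 * X 3}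
    let I : Ideal (MvPolynomial (Fin 4) ℂ) :=
      Ideal.span {(X 1 : MvPolynomial (Fin 4) ℂ) * X 2, X 1 * X 3, X 2 * X 3} ⊔ IG
    let fam : Fin 8 → MvPolynomial (Fin 4) ℂ ⧸ I :=
      ![Ideal.Quotient.mk I 1, Ideal.Quotient.mk I (X 0), Ideal.Quotient.mk I (X 1),
        Ideal.Quotient.mk I (X 2), Ideal.Quotient.mk I (X 3),
        Ideal.Quotient.mk I (X 0 * X 1), Ideal.Quotient.mk I (X 0 * X 2),
        Ideal.Quotient.mk I (X 0 * X 3)]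
    (∀ g : ArGroup 1 4, ∀ p ∈ I, actA (g : Fin 4 → ℂˣ) p ∈ I) ∧
    Module.finrank ℂ (MvPolynomial (Fin 4) ℂ ⧸ I) = 8 ∧
    LinearIndependent ℂ fam ∧
    Submodule.span ℂ (Set.range fam) = ⊤ ∧
    ∀ ρ : ArGroup 1 4 →* ℂˣ,
      ∃ w ∈ iso 1 4 I ρ, w ≠ 0 ∧ ∀ w' ∈ iso 1 4 I ρ, ∃ a : ℂ, w' = a • w := by
  intro IG I fam
  have hI : I = monomialIdeal genExponents := monomialIdeal_genExponents.symm
  have hfam : fam = fun i => Ideal.Quotient.mk I (monomial (stdExponent i) (1 : ℂ)) := by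
    funext i
    fin_cases i <;> simp [fam, stdExponent, monomial_expVec]
  rw [hfam]
  clear_value I
  subst hI
  have hli := linearIndependent_mk_monomial stdExponent_injective
    fun i => (forall_genExponents_not_le_iff _).mpr ⟨i, rfl⟩
  have hspan := span_mk_monomial_eq_top fun m => (forall_genExponents_not_le_iff m).mp
  refine ⟨fun g p hp => actA_mem_monomialIdeal _ hp, ?_, hli, hspan, fun ρ => ?_⟩
  · simpa using Module.finrank_eq_card_basis (Module.Basis.mk hli hspan.ge)
  · obtain ⟨i, hi, huniq⟩ := existsUnique_monomialChar_eq ρ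
    refine exists_iso_generator ((forall_genExponents_not_le_iff _).mpr ⟨i, rfl⟩)
      ((forall_prod_eq_iff _ ρ).mpr hi) fun m hm hmρ => ?_
    obtain ⟨j, rfl⟩ := (forall_genExponents_not_le_iff m).mp hm
    rw [huniq j ((forall_prod_eq_iff _ ρ).mp hmρ)]
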